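/- (100%-structured inverse theorem) Let n ≥ 1, d ≥ 1, and suppose f: F₂ⁿ → [−1,1] satisfies ‖f‖_{U^d(F₂ⁿ)} = 1. Then f is a Reed-Muller code of order at most d−1; that is, there exists a polynomial P: F₂ⁿ → F₂ in n variables over F₂ of degree at most d−1 such that f(x) = (−1)^{P(x)} for all x ∈ F₂ⁿ. -/

import Mathlib

/-- The `2^d`-th power of the Gowers uniformity norm `‖f‖_{U^d(F₂ⁿ)}`:
the average of `∏_{ω ∈ {0,1}^d} f(x + ω₁h₁ + ⋯ + ω_dh_d)` over `x, h₁, …, h_d ∈ F₂ⁿ`. -/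
noncomputable def gowersPow (n d : ℕ) (f : (Fin n → ZMod 2) → ℝ) : ℝ :=
  (∑ x : Fin n → ZMod 2, ∑ h : Fin d → (Fin n → ZMod 2),
      ∏ ω : Fin d → ZMod 2, f (x + ∑ i, ω i • h i)) /
    ((Fintype.card (Fin n → ZMod 2) : ℝ) *
      (Fintype.card (Fin d → (Fin n → ZMod 2)) : ℝ))

/-- The Gowers uniformity norm `‖f‖_{U^d(F₂ⁿ)}`, the nonnegative `2^d`-th root of
the Gowers average `gowersPow n d f`. -/
noncomputable def gowersNorm (n d : ℕ) (f : (Fin n → ZMod 2) → ℝ) : ℝ :=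
  Real.rpow (gowersPow n d f) ((2 : ℝ) ^ d)⁻¹

def indVec {n : ℕ} (T : Finset (Fin n)) : Fin n → ZMod 2 := fun j => if j ∈ T then 1 else 0

lemma indVec_insert {n : ℕ} (a : Fin n) (T : Finset (Fin n)) (ha : a ∉ T) :
    indVec (insert a T) = indVec {a} + indVec T := by
  funext j
  simp only [indVec, Finset.mem_insert, Finset.mem_singleton, Pi.add_apply]
  by_cases h : j = a
  · subst h; simp [ha]
  · simp [h]

lemma moebius_two {n : ℕ} (U : Finset (Fin n)) : ∀ A : Finset (Fin n) → ZMod 2,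
    ∑ S ∈ U.powerset, ∑ T ∈ S.powerset, A T = A U := by
  induction U using Finset.induction_on with
  | empty => intro A; simp
  | insert a U ha ih =>
    intro A
    rw [Finset.sum_powerset_insert ha, ih A]
    have h1 : ∀ S ∈ U.powerset, ∑ T ∈ (insert a S).powerset, A T =
        ∑ T ∈ S.powerset, A T + ∑ T ∈ S.powerset, A (insert a T) := by
      intro S hS
      exact Finset.sum_powerset_insert (fun h => ha (Finset.mem_powerset.mp hS h)) A
    rw [Finset.sum_congr rfl h1, Finset.sum_add_distrib, ih A, ih (fun T => A (insert a T)),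
      ← add_assoc, CharTwo.add_self_eq_zero, zero_add]

lemma vanish_base {n d : ℕ} (F : (Fin n → ZMod 2) → ZMod 2)
    (hF : ∀ x (h : Fin d → (Fin n → ZMod 2)), ∑ ω : Fin d → ZMod 2, F (x + ∑ i, ω i • h i) = 0)
    (S : Finset (Fin n)) (hS : S.card = d) (x : Fin n → ZMod 2) :
    ∑ T ∈ S.powerset, F (x + indVec T) = 0 := by
  classical
  have hz : ∀ z : ZMod 2, z = 0 ∨ z = 1 := by decide
  let e : Fin d ↪ Fin n := (S.orderEmbOfFin hS).toEmbedding
  have he : ∀ j, j ∈ S ↔ ∃ k, e k = j := by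
    intro j
    have := Finset.range_orderEmbOfFin S hS
    rw [← Finset.mem_coe, ← this]; rfl
  rw [← hF x (fun i => indVec {e i})]
  symm
  refine Finset.sum_nbij' (fun ω => (Finset.univ.filter (fun k => ω k = 1)).map e)
    (fun T k => if e k ∈ T then 1 else 0) ?_ ?_ ?_ ?_ ?_
  · intro ω _
    rw [Finset.mem_powerset]
    intro j hj
    rw [Finset.mem_map] at hj
    obtain ⟨k, _, rfl⟩ := hj
    exact (he _).2 ⟨k, rfl⟩
  · intro T _; exact Finset.mem_univ _
  · intro ω _
    funext k
    rcases hz (ω k) with h | h <;> simp [h]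
  · intro T hT
    ext j
    rw [Finset.mem_powerset] at hT
    simp only [Finset.mem_map, Finset.mem_filter, Finset.mem_univ, true_and]
    constructor
    · rintro ⟨k, hk, rfl⟩
      by_contra hc
      simp [hc] at hk
    · intro hj
      obtain ⟨k, rfl⟩ := (he j).1 (hT hj)
      exact ⟨k, by simp [hj], rfl⟩
  · intro ω _
    congr 2
    funext j
    simp only [Finset.sum_apply, Pi.smul_apply, indVec, Finset.mem_singleton, smul_eq_mul,
      mul_ite, mul_one, mul_zero, Finset.mem_map, Finset.mem_filter, Finset.mem_univ, true_and]
    by_cases hj : ∃ k, e k = j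
    · obtain ⟨k, rfl⟩ := hj
      rcases hz (ω k) with h | h <;> simp [h]
    · push Not at hj
      rw [if_neg (by rintro ⟨k, _, hk⟩; exact hj k hk)]
      exact Finset.sum_eq_zero fun k _ => if_neg (fun h => hj k h.symm)

lemma vanish {n d : ℕ} (F : (Fin n → ZMod 2) → ZMod 2)
    (hF : ∀ x (h : Fin d → (Fin n → ZMod 2)), ∑ ω : Fin d → ZMod 2, F (x + ∑ i, ω i • h i) = 0)
    (S : Finset (Fin n)) : d ≤ S.card → ∀ x : Fin n → ZMod 2,
    ∑ T ∈ S.powerset, F (x + indVec T) = 0 := by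
  induction S using Finset.induction_on with
  | empty =>
    intro h x
    exact vanish_base F hF _ (by simp at h ⊢; omega) x
  | insert a S ha ih =>
    intro h x
    rcases h.eq_or_lt with h | h
    · exact vanish_base F hF _ h.symm x
    · rw [Finset.card_insert_of_notMem ha] at h
      rw [Finset.sum_powerset_insert ha, ih (by omega) x, zero_add,
        ← ih (by omega) (x + indVec {a})]
      refine Finset.sum_congr rfl fun T hT => ?_
      rw [indVec_insert a T (fun h => ha (Finset.mem_powerset.mp hT h)), add_assoc]

lemma poly_exists {n d : ℕ} (hd : 1 ≤ d) (F : (Fin n → ZMod 2) → ZMod 2)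
    (hF : ∀ x (h : Fin d → (Fin n → ZMod 2)), ∑ ω : Fin d → ZMod 2, F (x + ∑ i, ω i • h i) = 0) :
    ∃ P : MvPolynomial (Fin n) (ZMod 2), P.totalDegree ≤ d - 1 ∧
      ∀ x, F x = MvPolynomial.eval x P := by
  classical
  have hz : ∀ z : ZMod 2, z = 0 ∨ z = 1 := by decide
  let c : Finset (Fin n) → ZMod 2 := fun S => ∑ T ∈ S.powerset, F (indVec T)
  have hc : ∀ S, d ≤ S.card → c S = 0 := by
    intro S hS
    simpa using vanish F hF S hS 0
  refine ⟨∑ S : Finset (Fin n), MvPolynomial.C (c S) * ∏ i ∈ S, MvPolynomial.X i, ?_, ?_⟩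
  · refine MvPolynomial.totalDegree_finsetSum_le fun S _ => ?_
    by_cases hS : d ≤ S.card
    · simp [hc S hS]
    · refine (MvPolynomial.totalDegree_mul _ _).trans ?_
      have := MvPolynomial.totalDegree_finsetProd S
        (fun i => (MvPolynomial.X i : MvPolynomial (Fin n) (ZMod 2)))
      simp at this
      simp only [MvPolynomial.totalDegree_C]
      omega
  · intro x
    let U : Finset (Fin n) := Finset.univ.filter (fun i => x i = 1)
    have hU : indVec U = x := by
      funext j
      rcases hz (x j) with h | h <;> simp [indVec, U, h]
    have h1 := moebius_two U (fun T => F (indVec T))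
    rw [hU] at h1
    rw [← h1]
    simp only [map_sum, map_mul, map_prod, MvPolynomial.eval_C, MvPolynomial.eval_X]
    rw [← Finset.sum_subset (Finset.subset_univ U.powerset)]
    · refine Finset.sum_congr rfl fun S hS => ?_
      rw [Finset.prod_eq_one, mul_one]
      intro i hi
      have := Finset.mem_powerset.mp hS hi
      simpa [U] using this
    · intro S _ hS
      rw [Finset.mem_powerset, Finset.not_subset] at hS
      obtain ⟨i, hi, hiU⟩ := hS
      rw [Finset.prod_eq_zero hi, mul_zero]
      rcases hz (x i) with h | h
      · exact h
      · simp [U, h] at hiU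

lemma all_one {ι : Type*} [Fintype ι] (g : ι → ℝ) (hg : ∀ i, g i ≤ 1)
    (hs : ∑ i, g i = Fintype.card ι) (i : ι) : g i = 1 := by
  have h : ∑ i, g i = ∑ _i : ι, (1 : ℝ) := by simp [hs]
  exact (Finset.sum_eq_sum_iff_of_le (fun i _ => hg i)).1 h i (Finset.mem_univ i)

/-- the 100%-structured inverse theorem: a `[-1,1]`-valued function
with `U^d` norm exactly `1` is a Reed-Muller code of order at most `d-1`. -/
theorem structured_inverse_theorem_100 (n : ℕ) (hn : 1 ≤ n) (d : ℕ) (hd : 1 ≤ d)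
    (f : (Fin n → ZMod 2) → ℝ) (hf : ∀ x, f x ∈ Set.Icc (-1 : ℝ) 1)
    (hfU : gowersNorm n d f = 1) :
    ∃ P : MvPolynomial (Fin n) (ZMod 2), P.totalDegree ≤ d - 1 ∧
      ∀ x, f x = (-1 : ℝ) ^ (MvPolynomial.eval x P).val := by
  classical
  have hfa : ∀ x, |f x| ≤ 1 := fun x => abs_le.2 (hf x)
  let g : (Fin n → ZMod 2) × (Fin d → (Fin n → ZMod 2)) → ℝ :=
    fun p => ∏ ω : Fin d → ZMod 2, f (p.1 + ∑ i, ω i • p.2 i)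
  have hga : ∀ p, |g p| ≤ 1 := by
    intro p
    simp only [g, Finset.abs_prod]
    exact Finset.prod_le_one (fun _ _ => abs_nonneg _) (fun _ _ => hfa _)
  have hcard : (0 : ℝ) < Fintype.card ((Fin n → ZMod 2) × (Fin d → (Fin n → ZMod 2))) := by
    exact_mod_cast Fintype.card_pos
  have hG : gowersPow n d f = (∑ p, g p) /
      Fintype.card ((Fin n → ZMod 2) × (Fin d → (Fin n → ZMod 2))) := by
    unfold gowersPow
    rw [Fintype.sum_prod_type, Fintype.card_prod, Nat.cast_mul]
  have habs : |gowersPow n d f| ≤ 1 := by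
    rw [hG, abs_div, abs_of_pos hcard, div_le_one hcard]
    refine (Finset.abs_sum_le_sum_abs _ _).trans ?_
    refine (Finset.sum_le_sum (fun p _ => hga p)).trans ?_
    simp
  have hc0 : (0 : ℝ) < ((2 : ℝ) ^ d)⁻¹ := by positivity
  have hc1 : ((2 : ℝ) ^ d)⁻¹ ≤ 1 := inv_le_one_of_one_le₀ (one_le_pow₀ (by norm_num))
  have hone : gowersPow n d f = 1 := by
    unfold gowersNorm at hfU
    change gowersPow n d f ^ ((2 : ℝ) ^ d)⁻¹ = 1 at hfU
    generalize gowersPow n d f = a at *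
    generalize ((2 : ℝ) ^ d)⁻¹ = c at *
    rcases lt_or_ge a 0 with ha | ha
    · exfalso
      rw [Real.rpow_def_of_neg ha] at hfU
      have hl : Real.log a ≤ 0 := by
        rw [← Real.log_abs]
        exact Real.log_nonpos (abs_nonneg _) habs
      have he : Real.exp (Real.log a * c) ≤ 1 :=
        Real.exp_le_one_iff.2 (mul_nonpos_of_nonpos_of_nonneg hl hc0.le)
      have hpos := Real.exp_pos (Real.log a * c)
      have hcos : Real.cos (c * Real.pi) < 1 := by
        rw [← Real.cos_zero]
        exact Real.cos_lt_cos_of_nonneg_of_le_pi le_rfl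
          (by nlinarith [Real.pi_pos]) (by positivity)
      nlinarith
    · have ha1 : a ≤ 1 := (le_abs_self a).trans habs
      rcases ha1.eq_or_lt with h | h
      · exact h
      · have := Real.rpow_lt_one ha h hc0
        linarith
  have hg1 : ∀ p, g p = 1 := by
    refine all_one g (fun p => (le_abs_self _).trans (hga p)) ?_
    rw [hG, div_eq_one_iff_eq hcard.ne'] at hone
    exact hone
  have hpm : ∀ x, f x = 1 ∨ f x = -1 := by
    intro x
    have h := hg1 (x, 0)
    simp only [g, Pi.zero_apply, smul_zero, Finset.sum_const_zero, add_zero, Finset.prod_const]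
      at h
    have h2 : |f x| ^ (Finset.univ : Finset (Fin d → ZMod 2)).card = 1 := by
      rw [← abs_pow, h, abs_one]
    rw [pow_eq_one_iff_of_nonneg (abs_nonneg _) (Finset.card_pos.2 Finset.univ_nonempty).ne'] at h2
    exact (abs_eq zero_le_one).1 h2
  let F : (Fin n → ZMod 2) → ZMod 2 := fun x => if f x = 1 then 0 else 1
  have hFf : ∀ x, f x = (-1 : ℝ) ^ (F x).val := by
    intro x
    rcases hpm x with h | h
    · simp [F, h]
    · have : F x = 1 := by simp only [F, h]; norm_num
      rw [this, h, show (1 : ZMod 2).val = 1 from rfl]; norm_num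
  have hF : ∀ x (h : Fin d → (Fin n → ZMod 2)),
      ∑ ω : Fin d → ZMod 2, F (x + ∑ i, ω i • h i) = 0 := by
    intro x h
    have h1 := hg1 (x, h)
    simp only [g] at h1
    rw [Finset.prod_congr rfl (fun ω _ => hFf _), Finset.prod_pow_eq_pow_sum,
      neg_one_pow_eq_one_iff_even (by norm_num)] at h1
    have h2 := (ZMod.natCast_eq_zero_iff_even).2 h1
    rw [Nat.cast_sum] at h2
    simpa using h2
  obtain ⟨P, hP, hPe⟩ := poly_exists hd F hF
  exact ⟨P, hP, fun x => by rw [← hPe x]; exact hFf x⟩
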